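/- With the notations of the context, for all z ∈ ℂ and all (s, τ) ∈ ℝ² the compatibility condition ∂U(z; s, τ)/∂τ = ∂W(z; s, τ)/∂z − U(z; s, τ)·W(z; s, τ) + W(z; s, τ)·U(z; s, τ) holds as an identity of 4×4 complex matrices. -/

import Mathlib

open Real Complex

set_option maxHeartbeats 4000000 in
/-- The `τ`-compatibility condition as an algebraic identity. Here `e`, `h`, `w` are rescaled
versions of `q(σ) / D`, `q'(σ) / D` and `D ^ 2`, and `d'`, `dt'`, `c'`, `ct'`, `h'`, `ht'` are the
`τ`-derivatives of `d`, `dt`, `c`, `ct`, `h`, `w * h`. -/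
lemma zero_curvature_identity {r₁ r₂ s₁ s₂ τ e h w S L y v c ct d dt b bt β βt
    c' ct' d' dt' h' ht' f ft : ℂ} (z : ℂ)
    (hr₁ : r₁ ≠ 0) (hr₂ : r₂ ≠ 0) (hS₀ : S ≠ 0) (hS : S = r₁ ^ 2 + r₂ ^ 2)
    (hL : L = (r₁ ^ 4 - r₂ ^ 4) * τ ^ 2 + 2 * (r₂ * s₂ - r₁ * s₁))
    (hy : y = 2 * (s₁ * r₂ + s₂ * r₁) - S * r₁ * r₂ * τ ^ 2)
    (hv : v = S * r₁ ^ 2 * r₂ ^ 2 * w * h ^ 2 - y * r₁ * r₂ * w * e ^ 2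
      - S * r₁ ^ 2 * r₂ ^ 2 * w ^ 2 * e ^ 4)
    (hc : c = (s₁ ^ 2 - v) / r₁) (hct : ct = (s₂ ^ 2 - v) / r₂)
    (hd : d = r₁ * e) (hdt : dt = r₂ * w * e)
    (hb : b = (ct + τ * r₂) * d - r₁ ^ 2 * h)
    (hbt : bt = (c + τ * r₁) * dt - r₂ ^ 2 * (w * h))
    (hβ : β = (ct - τ * r₂) * dt - r₁ * r₂ * (w * h))
    (hβt : βt = (c - τ * r₁) * d - r₁ * r₂ * h)
    (hc' : c' = -2 * S * τ * r₂ * d * dt) (hct' : ct' = -2 * S * τ * r₁ * d * dt)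
    (hd' : d' = -2 * S * τ * r₁ ^ 2 * r₂ * h - L * d)
    (hdt' : dt' = -2 * S * τ * r₁ * r₂ ^ 2 * (w * h) + L * dt)
    (hh' : h' = -2 * τ * e * y - 4 * S * τ * r₁ * r₂ * w * e ^ 3 - L * h)
    (hht' : ht' = -2 * τ * w * e * y - 4 * S * τ * r₁ * r₂ * w ^ 2 * e ^ 3 + L * (w * h))
    (hf : f = r₁⁻¹ * (-(r₂ / S) * d' + (-(r₁ * c) - r₂ * ct + S * τ) * b
      - r₁ * d ^ 2 * dt + r₂ * ct ^ 2 * d - 2 * s₂ * d))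
    (hft : ft = r₂⁻¹ * (-(r₁ / S) * dt' + (-(r₁ * c) - r₂ * ct + S * τ) * bt
      - r₂ * dt ^ 2 * d + r₁ * c ^ 2 * dt - 2 * s₁ * dt))
    {U U' W W' : Matrix (Fin 4) (Fin 4) ℂ}
    (hU : U = !![-(r₁ * c) + r₁ ^ 2 * τ, r₂ * d, r₁ * Complex.I, 0;
      -(r₁ * dt), r₂ * ct - r₂ ^ 2 * τ, 0, r₂ * Complex.I;
      Complex.I * ((r₁ * c ^ 2 - r₂ * d * dt - 2 * s₁) + r₁ * z),
        -Complex.I * (r₁ * b + r₂ * βt), r₁ * c + r₁ ^ 2 * τ, r₁ * d;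
      -Complex.I * (r₁ * β + r₂ * bt),
        Complex.I * ((r₂ * ct ^ 2 - r₁ * d * dt - 2 * s₂) - r₂ * z),
        -(r₂ * dt), -(r₂ * ct) - r₂ ^ 2 * τ])
    (hU' : U' = !![-(r₁ * c') + r₁ ^ 2, r₂ * d', 0, 0;
      -(r₁ * dt'), r₂ * ct' - r₂ ^ 2, 0, 0;
      Complex.I * (2 * r₁ * c * c' - r₂ * (d' * dt + d * dt')),
        -Complex.I * (r₁ * ((ct' + r₂) * d + (ct + τ * r₂) * d' - r₁ ^ 2 * h')
          + r₂ * ((c' - r₁) * d + (c - τ * r₁) * d' - r₁ * r₂ * h')),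
        r₁ * c' + r₁ ^ 2, r₁ * d';
      -Complex.I * (r₁ * ((ct' - r₂) * dt + (ct - τ * r₂) * dt' - r₁ * r₂ * ht')
          + r₂ * ((c' + r₁) * dt + (c + τ * r₁) * dt' - r₂ ^ 2 * ht')),
        Complex.I * (2 * r₂ * ct * ct' - r₁ * (d' * dt + d * dt')),
        -(r₂ * dt'), -(r₂ * ct') - r₂ ^ 2])
    (hW : W = !![r₁ ^ 2 * z, -(S * b), 0, -(S * d) * Complex.I;
      -(S * bt), -r₂ ^ 2 * z, S * dt * Complex.I, 0;
      0, -(S * f) * Complex.I, r₁ ^ 2 * z, -(S * βt);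
      S * ft * Complex.I, 0, -(S * β), -r₂ ^ 2 * z])
    (hW' : W' = !![r₁ ^ 2, 0, 0, 0; 0, -r₂ ^ 2, 0, 0; 0, 0, r₁ ^ 2, 0; 0, 0, 0, -r₂ ^ 2])
    (i j : Fin 4) :
    U' i j = W' i j - (U * W) i j + (W * U) i j := by
  have hI : Complex.I ^ 2 = -1 := Complex.I_sq
  have hSf : S * f = r₁⁻¹ * (-r₂ * d' + S * ((-(r₁ * c) - r₂ * ct + S * τ) * b
      - r₁ * d ^ 2 * dt + r₂ * ct ^ 2 * d - 2 * s₂ * d)) := by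
    rw [hf]; field_simp; ring
  have hSft : S * ft = r₂⁻¹ * (-r₁ * dt' + S * ((-(r₁ * c) - r₂ * ct + S * τ) * bt
      - r₂ * dt ^ 2 * d + r₁ * c ^ 2 * dt - 2 * s₁ * dt)) := by
    rw [hft]; field_simp; ring
  rw [hSf, hSft] at hW
  clear hSf hSft hf hft
  subst hU hU' hW hW'
  generalize Complex.I = J at *
  fin_cases i <;> fin_cases j <;>
    simp [Matrix.mul_apply, Fin.sum_univ_four] <;>
    subst hb hbt hβ hβt hc' hct' hd' hdt' hh' hht' hd hdt hc hct hv hy hL <;>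
    field_simp <;> (try rw [hI]) <;> (try rw [hS]) <;> ring

/-- Differentiating the Painlevé II Hamiltonian along a solution. -/
lemma hasDerivAt_painleveII_hamiltonian {q qp u : ℝ → ℝ}
    (hq : ∀ x, HasDerivAt q (qp x) x)
    (hqp : ∀ x, HasDerivAt qp (x * q x + 2 * q x ^ 3) x)
    (hu : ∀ x, u x = qp x ^ 2 - x * q x ^ 2 - q x ^ 4) (x : ℝ) :
    HasDerivAt u (-q x ^ 2) x := by
  rw [show u = fun x => qp x ^ 2 - x * q x ^ 2 - q x ^ 4 from funext hu]
  refine ((((hqp x).fun_pow 2).sub ((hasDerivAt_id' x).mul ((hq x).fun_pow 2))).sub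
    ((hq x).fun_pow 4)).congr_deriv ?_
  push_cast
  ring

lemma cube_eq_of_eq_rpow {r₁ r₂ C : ℝ} (hr₁ : 0 < r₁) (hr₂ : 0 < r₂)
    (hC : C = ((r₁ ^ 2)⁻¹ + (r₂ ^ 2)⁻¹) ^ ((1 : ℝ) / 3)) :
    0 < C ∧ C ^ 3 * (r₁ ^ 2 * r₂ ^ 2) = r₁ ^ 2 + r₂ ^ 2 := by
  have h0 : 0 < (r₁ ^ 2)⁻¹ + (r₂ ^ 2)⁻¹ := by positivity
  refine ⟨hC ▸ Real.rpow_pos_of_pos h0 _, ?_⟩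
  have h3 : C ^ 3 = (r₁ ^ 2)⁻¹ + (r₂ ^ 2)⁻¹ := by
    rw [hC, ← Real.rpow_natCast, ← Real.rpow_mul h0.le]
    norm_num
  rw [h3]
  field_simp
  ring

/-- **The `τ`-compatibility condition of the Lax pair for the tacnode Riemann–Hilbert
problem**: `∂U/∂τ = ∂W/∂z - U W + W U`, verified directly from the Painlevé II equation. -/
theorem Lax_pair_tau_compatibility
    (q qp : ℝ → ℝ)
    (hq : ∀ x, HasDerivAt q (qp x) x)
    (hqp : ∀ x, HasDerivAt qp (x * q x + 2 * q x ^ 3) x)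
    (u : ℝ → ℝ) (hu : ∀ x, u x = qp x ^ 2 - x * q x ^ 2 - q x ^ 4)
    (r₁ r₂ : ℝ) (hr₁ : 0 < r₁) (hr₂ : 0 < r₂) (σ₁ σ₂ : ℝ)
    (C : ℝ) (hC : C = ((r₁ ^ 2)⁻¹ + (r₂ ^ 2)⁻¹) ^ ((1 : ℝ) / 3))
    (Df σf df dtf cf ctf bf btf βf βtf : ℝ → ℝ → ℝ)
    (hDf : ∀ s τ, Df s τ = Real.sqrt (r₁ / r₂) *
      Real.exp ((r₁ ^ 4 - r₂ ^ 4) * τ ^ 3 / 3 + 2 * (r₂ * (σ₂ * s) - r₁ * (σ₁ * s)) * τ))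
    (hσf : ∀ s τ, σf s τ =
      C⁻¹ * (2 * (σ₁ * s / r₁ + σ₂ * s / r₂) - (r₁ ^ 2 + r₂ ^ 2) * τ ^ 2))
    (hdf : ∀ s τ, df s τ = q (σf s τ) / (r₂ * C * Df s τ))
    (hdtf : ∀ s τ, dtf s τ = Df s τ * q (σf s τ) / (r₁ * C))
    (hcf : ∀ s τ, cf s τ = ((σ₁ * s) ^ 2 - C⁻¹ * u (σf s τ)) / r₁)
    (hctf : ∀ s τ, ctf s τ = ((σ₂ * s) ^ 2 - C⁻¹ * u (σf s τ)) / r₂)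
    (hbf : ∀ s τ, bf s τ = (ctf s τ + τ * r₂) * df s τ - qp (σf s τ) / (r₂ ^ 2 * C ^ 2 * Df s τ))
    (hbtf : ∀ s τ, btf s τ = (cf s τ + τ * r₁) * dtf s τ - Df s τ * qp (σf s τ) / (r₁ ^ 2 * C ^ 2))
    (hβf : ∀ s τ, βf s τ = (ctf s τ - τ * r₂) * dtf s τ - Df s τ * qp (σf s τ) / (r₁ * r₂ * C ^ 2))
    (hβtf : ∀ s τ, βtf s τ = (cf s τ - τ * r₁) * df s τ - qp (σf s τ) / (r₁ * r₂ * C ^ 2 * Df s τ))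
    (ff ftf : ℝ → ℝ → ℝ)
    (hff : ∀ s τ, ff s τ = r₁⁻¹ *
      (-(r₂ / (r₁ ^ 2 + r₂ ^ 2)) * deriv (fun τ' => df s τ') τ
        + (-(r₁ * cf s τ) - r₂ * ctf s τ + (r₁ ^ 2 + r₂ ^ 2) * τ) * bf s τ
        - r₁ * df s τ ^ 2 * dtf s τ + r₂ * ctf s τ ^ 2 * df s τ - 2 * (σ₂ * s) * df s τ))
    (hftf : ∀ s τ, ftf s τ = r₂⁻¹ *
      (-(r₁ / (r₁ ^ 2 + r₂ ^ 2)) * deriv (fun τ' => dtf s τ') τ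
        + (-(r₁ * cf s τ) - r₂ * ctf s τ + (r₁ ^ 2 + r₂ ^ 2) * τ) * btf s τ
        - r₂ * dtf s τ ^ 2 * df s τ + r₁ * cf s τ ^ 2 * dtf s τ - 2 * (σ₁ * s) * dtf s τ))
    (U W : ℂ → ℝ → ℝ → Matrix (Fin 4) (Fin 4) ℂ)
    (hU : ∀ (z : ℂ) (s τ : ℝ), U z s τ =
      !![((-(r₁ * cf s τ) + r₁ ^ 2 * τ : ℝ) : ℂ), ((r₂ * df s τ : ℝ) : ℂ),
            (r₁ : ℂ) * Complex.I, 0;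
        ((-(r₁ * dtf s τ) : ℝ) : ℂ), ((r₂ * ctf s τ - r₂ ^ 2 * τ : ℝ) : ℂ), 0,
            (r₂ : ℂ) * Complex.I;
        Complex.I * (((r₁ * cf s τ ^ 2 - r₂ * df s τ * dtf s τ - 2 * (σ₁ * s) : ℝ) : ℂ)
              + (r₁ : ℂ) * z),
          -Complex.I * ((r₁ * bf s τ + r₂ * βtf s τ : ℝ) : ℂ),
          ((r₁ * cf s τ + r₁ ^ 2 * τ : ℝ) : ℂ), ((r₁ * df s τ : ℝ) : ℂ);
        -Complex.I * ((r₁ * βf s τ + r₂ * btf s τ : ℝ) : ℂ),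
          Complex.I * (((r₂ * ctf s τ ^ 2 - r₁ * df s τ * dtf s τ - 2 * (σ₂ * s) : ℝ) : ℂ)
              - (r₂ : ℂ) * z),
          ((-(r₂ * dtf s τ) : ℝ) : ℂ), ((-(r₂ * ctf s τ) - r₂ ^ 2 * τ : ℝ) : ℂ)])
    (hW : ∀ (z : ℂ) (s τ : ℝ), W z s τ =
      !![((r₁ ^ 2 : ℝ) : ℂ) * z, ((-((r₁ ^ 2 + r₂ ^ 2) * bf s τ) : ℝ) : ℂ), 0,
            -(((r₁ ^ 2 + r₂ ^ 2) * df s τ : ℝ) : ℂ) * Complex.I;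
        ((-((r₁ ^ 2 + r₂ ^ 2) * btf s τ) : ℝ) : ℂ), -((r₂ ^ 2 : ℝ) : ℂ) * z,
            (((r₁ ^ 2 + r₂ ^ 2) * dtf s τ : ℝ) : ℂ) * Complex.I, 0;
        0, -(((r₁ ^ 2 + r₂ ^ 2) * ff s τ : ℝ) : ℂ) * Complex.I, ((r₁ ^ 2 : ℝ) : ℂ) * z,
            ((-((r₁ ^ 2 + r₂ ^ 2) * βtf s τ) : ℝ) : ℂ);
        (((r₁ ^ 2 + r₂ ^ 2) * ftf s τ : ℝ) : ℂ) * Complex.I, 0,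
            ((-((r₁ ^ 2 + r₂ ^ 2) * βf s τ) : ℝ) : ℂ), -((r₂ ^ 2 : ℝ) : ℂ) * z]) :
    ∀ (z : ℂ) (s τ : ℝ) (i j : Fin 4),
      HasDerivAt (fun τ' => U z s τ' i j)
        (deriv (fun z' => W z' s τ i j) z
          - (U z s τ * W z s τ) i j + (W z s τ * U z s τ) i j) τ := by
  intro z s τ i j
  obtain ⟨hC₀, hC₃⟩ := cube_eq_of_eq_rpow hr₁ hr₂ hC
  have hD₀ : Df s τ ≠ 0 := by
    rw [hDf]
    have := Real.sqrt_pos.2 (div_pos hr₁ hr₂)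
    positivity
  have hS₀ : r₁ ^ 2 + r₂ ^ 2 ≠ 0 := by positivity
  obtain ⟨S, hS⟩ : ∃ S, S = r₁ ^ 2 + r₂ ^ 2 := ⟨_, rfl⟩
  obtain ⟨L, hL⟩ : ∃ L, L = (r₁ ^ 4 - r₂ ^ 4) * τ ^ 2 + 2 * (r₂ * (σ₂ * s) - r₁ * (σ₁ * s)) :=
    ⟨_, rfl⟩
  obtain ⟨y, hy⟩ : ∃ y, y = 2 * (σ₁ * s * r₂ + σ₂ * s * r₁) - S * r₁ * r₂ * τ ^ 2 := ⟨_, rfl⟩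
  obtain ⟨e, he⟩ : ∃ e, e = q (σf s τ) / (r₁ * r₂ * C * Df s τ) := ⟨_, rfl⟩
  obtain ⟨h, hh⟩ : ∃ h, h = qp (σf s τ) / (r₁ ^ 2 * r₂ ^ 2 * C ^ 2 * Df s τ) := ⟨_, rfl⟩
  have hσ : σf s τ = y / (r₁ * r₂ * C) := by
    rw [hσf, hy, hS]; field_simp
  obtain ⟨v, hv'⟩ : ∃ v, v = C⁻¹ * u (σf s τ) := ⟨_, rfl⟩
  have hqe : q (σf s τ) = r₁ * r₂ * C * Df s τ * e := by rw [he]; field_simp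
  have hph : qp (σf s τ) = r₁ ^ 2 * r₂ ^ 2 * C ^ 2 * Df s τ * h := by rw [hh]; field_simp
  have hSC : S = C ^ 3 * (r₁ ^ 2 * r₂ ^ 2) := by rw [hS, hC₃]
  have hv : v = S * r₁ ^ 2 * r₂ ^ 2 * Df s τ ^ 2 * h ^ 2 - y * r₁ * r₂ * Df s τ ^ 2 * e ^ 2
      - S * r₁ ^ 2 * r₂ ^ 2 * (Df s τ ^ 2) ^ 2 * e ^ 4 := by
    rw [hv', hu, hph, hqe, hσ, hSC]; field_simp
  have hc : cf s τ = ((σ₁ * s) ^ 2 - v) / r₁ := by rw [hcf, hv']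
  have hct : ctf s τ = ((σ₂ * s) ^ 2 - v) / r₂ := by rw [hctf, hv']
  have hd : df s τ = r₁ * e := by rw [hdf, hqe]; field_simp
  have hdt : dtf s τ = r₂ * Df s τ ^ 2 * e := by rw [hdtf, hqe]; field_simp
  have hb : bf s τ = (ctf s τ + τ * r₂) * df s τ - r₁ ^ 2 * h := by
    rw [hbf, hph]; field_simp
  have hbt : btf s τ = (cf s τ + τ * r₁) * dtf s τ - r₂ ^ 2 * (Df s τ ^ 2 * h) := by
    rw [hbtf, hph]; field_simp
  have hβ : βf s τ = (ctf s τ - τ * r₂) * dtf s τ - r₁ * r₂ * (Df s τ ^ 2 * h) := by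
    rw [hβf, hph]; field_simp
  have hβt : βtf s τ = (cf s τ - τ * r₁) * df s τ - r₁ * r₂ * h := by
    rw [hβtf, hph]; field_simp
  -- derivatives of the scalar functions
  have dτ : HasDerivAt (fun t : ℝ => t) 1 τ := hasDerivAt_id' τ
  have dσ : HasDerivAt (σf s) (-2 * C⁻¹ * S * τ) τ := by
    rw [show σf s = _ from funext (hσf s), hS]
    refine ((((dτ.fun_pow 2).const_mul (r₁ ^ 2 + r₂ ^ 2)).const_sub _).const_mul
      C⁻¹).congr_deriv ?_
    push_cast; ring
  have dD : HasDerivAt (Df s) (L * Df s τ) τ := by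
    rw [hDf s τ, show Df s = _ from funext (hDf s), hL]
    refine (((((dτ.fun_pow 3).const_mul (r₁ ^ 4 - r₂ ^ 4)).div_const 3).add
      (dτ.const_mul (2 * (r₂ * (σ₂ * s) - r₁ * (σ₁ * s))))).exp.const_mul _).congr_deriv ?_
    simp only [Pi.add_apply]
    push_cast; ring
  have dq : HasDerivAt (fun t => q (σf s t)) _ τ := (hq _).comp τ dσ
  have dp : HasDerivAt (fun t => qp (σf s t)) _ τ := (hqp _).comp τ dσ
  have du : HasDerivAt (fun t => u (σf s t)) _ τ :=
    (hasDerivAt_painleveII_hamiltonian hq hqp hu _).comp τ dσ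
  have dd : HasDerivAt (df s) (-2 * S * τ * r₁ ^ 2 * r₂ * h - L * df s τ) τ := by
    rw [hd, show df s = _ from funext (hdf s)]
    refine (dq.div (dD.const_mul (r₂ * C)) (by positivity)).congr_deriv ?_
    rw [hqe, hph]; field_simp
  have ddt : HasDerivAt (dtf s)
      (-2 * S * τ * r₁ * r₂ ^ 2 * (Df s τ ^ 2 * h) + L * dtf s τ) τ := by
    rw [hdt, show dtf s = _ from funext (hdtf s)]
    refine ((dD.mul dq).div_const (r₁ * C)).congr_deriv ?_
    rw [hqe, hph]; field_simp; ring
  have dc : HasDerivAt (cf s) (-2 * S * τ * r₂ * df s τ * dtf s τ) τ := by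
    rw [hd, hdt, show cf s = _ from funext (hcf s)]
    refine (((du.const_mul C⁻¹).const_sub _).div_const r₁).congr_deriv ?_
    rw [hqe]; field_simp
  have dct : HasDerivAt (ctf s) (-2 * S * τ * r₁ * df s τ * dtf s τ) τ := by
    rw [hd, hdt, show ctf s = _ from funext (hctf s)]
    refine (((du.const_mul C⁻¹).const_sub _).div_const r₂).congr_deriv ?_
    rw [hqe]; field_simp
  obtain ⟨c', hc'⟩ : ∃ x, x = -2 * S * τ * r₂ * df s τ * dtf s τ := ⟨_, rfl⟩
  obtain ⟨ct', hct'⟩ : ∃ x, x = -2 * S * τ * r₁ * df s τ * dtf s τ := ⟨_, rfl⟩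
  obtain ⟨d', hd'⟩ : ∃ x, x = -2 * S * τ * r₁ ^ 2 * r₂ * h - L * df s τ := ⟨_, rfl⟩
  obtain ⟨dt', hdt'⟩ : ∃ x, x = -2 * S * τ * r₁ * r₂ ^ 2 * (Df s τ ^ 2 * h) + L * dtf s τ :=
    ⟨_, rfl⟩
  obtain ⟨h', hh'⟩ : ∃ x, x = -2 * τ * e * y - 4 * S * τ * r₁ * r₂ * Df s τ ^ 2 * e ^ 3 - L * h :=
    ⟨_, rfl⟩
  obtain ⟨ht', hht'⟩ : ∃ x, x = -2 * τ * Df s τ ^ 2 * e * y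
      - 4 * S * τ * r₁ * r₂ * (Df s τ ^ 2) ^ 2 * e ^ 3 + L * (Df s τ ^ 2 * h) := ⟨_, rfl⟩
  rw [← hc'] at dc
  rw [← hct'] at dct
  rw [← hd'] at dd
  rw [← hdt'] at ddt
  have db : HasDerivAt (bf s) ((ct' + r₂) * df s τ + (ctf s τ + τ * r₂) * d'
      - r₁ ^ 2 * h') τ := by
    rw [show bf s = _ from funext (hbf s)]
    refine (((dct.add (dτ.mul_const r₂)).mul dd).sub
      (dp.div (dD.const_mul (r₂ ^ 2 * C ^ 2)) (by positivity))).congr_deriv ?_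
    rw [hh', hqe, hph, hσ, hSC]; simp only [Pi.add_apply]; field_simp; ring
  have dbt : HasDerivAt (btf s) ((c' + r₁) * dtf s τ + (cf s τ + τ * r₁) * dt'
      - r₂ ^ 2 * ht') τ := by
    rw [show btf s = _ from funext (hbtf s)]
    refine (((dc.add (dτ.mul_const r₁)).mul ddt).sub
      ((dD.mul dp).div_const (r₁ ^ 2 * C ^ 2))).congr_deriv ?_
    rw [hht', hqe, hph, hσ, hSC]; simp only [Pi.add_apply]; field_simp; ring
  have dβ : HasDerivAt (βf s) ((ct' - r₂) * dtf s τ + (ctf s τ - τ * r₂) * dt'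
      - r₁ * r₂ * ht') τ := by
    rw [show βf s = _ from funext (hβf s)]
    refine (((dct.sub (dτ.mul_const r₂)).mul ddt).sub
      ((dD.mul dp).div_const (r₁ * r₂ * C ^ 2))).congr_deriv ?_
    rw [hht', hqe, hph, hσ, hSC]; simp only [Pi.sub_apply]; field_simp; ring
  have dβt : HasDerivAt (βtf s) ((c' - r₁) * df s τ + (cf s τ - τ * r₁) * d'
      - r₁ * r₂ * h') τ := by
    rw [show βtf s = _ from funext (hβtf s)]
    refine (((dc.sub (dτ.mul_const r₁)).mul dd).sub
      (dp.div (dD.const_mul (r₁ * r₂ * C ^ 2)) (by positivity))).congr_deriv ?_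
    rw [hh', hqe, hph, hσ, hSC]; simp only [Pi.sub_apply]; field_simp; ring
  have hf := hff s τ
  have hft := hftf s τ
  rw [show deriv (fun t => df s t) τ = d' from dd.deriv, ← hS] at hf
  rw [show deriv (fun t => dtf s t) τ = dt' from ddt.deriv, ← hS] at hft
  have hWd : deriv (fun z' => W z' s τ i j) z = (!![(r₁ : ℂ) ^ 2, 0, 0, 0; 0, -(r₂ : ℂ) ^ 2, 0, 0;
      0, 0, (r₁ : ℂ) ^ 2, 0; 0, 0, 0, -(r₂ : ℂ) ^ 2] : Matrix (Fin 4) (Fin 4) ℂ) i j := by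
    simp only [hW]
    fin_cases i <;> fin_cases j <;> simp
  rw [hWd, ← zero_curvature_identity (r₁ := r₁) (r₂ := r₂) (s₁ := (σ₁ * s : ℝ))
    (s₂ := (σ₂ * s : ℝ)) (τ := τ) (e := e) (h := h) (w := (Df s τ ^ 2 : ℝ)) (S := S) (L := L)
    (y := y) (v := v) (c := cf s τ) (ct := ctf s τ) (d := df s τ) (dt := dtf s τ) (b := bf s τ)
    (bt := btf s τ) (β := βf s τ) (βt := βtf s τ) (c' := c') (ct' := ct') (d' := d') (dt' := dt')
    (h' := h') (ht' := ht') (f := ff s τ) (ft := ftf s τ) z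
    (by exact_mod_cast hr₁.ne') (by exact_mod_cast hr₂.ne') (by rw [hS]; exact_mod_cast hS₀)
    (by exact_mod_cast hS) (by exact_mod_cast hL) (by exact_mod_cast hy) (by exact_mod_cast hv)
    (by exact_mod_cast hc) (by exact_mod_cast hct) (by exact_mod_cast hd) (by exact_mod_cast hdt)
    (by exact_mod_cast hb) (by exact_mod_cast hbt) (by exact_mod_cast hβ)
    (by exact_mod_cast hβt) (by exact_mod_cast hc') (by exact_mod_cast hct')
    (by exact_mod_cast hd') (by exact_mod_cast hdt') (by exact_mod_cast hh')
    (by exact_mod_cast hht') (by exact_mod_cast hf) (by exact_mod_cast hft)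
    (by rw [hU]; push_cast; rfl) rfl (by rw [hW, ← hS]; push_cast; rfl) rfl i j]
  simp only [hU]
  have k00 := ((dc.const_mul r₁).fun_neg.fun_add (dτ.const_mul (r₁ ^ 2))).ofReal_comp
  have k01 := (dd.const_mul r₂).ofReal_comp
  have k10 := (ddt.const_mul r₁).fun_neg.ofReal_comp
  have k11 := ((dct.const_mul r₂).fun_sub (dτ.const_mul (r₂ ^ 2))).ofReal_comp
  have k20 := ((((((dc.fun_pow 2).const_mul r₁).fun_sub ((dd.const_mul r₂).fun_mul ddt)).sub_const
    (2 * (σ₁ * s))).ofReal_comp).add_const ((r₁ : ℂ) * z)).const_mul Complex.I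
  have k21 := (((db.const_mul r₁).fun_add (dβt.const_mul r₂)).ofReal_comp).const_mul (-Complex.I)
  have k22 := ((dc.const_mul r₁).fun_add (dτ.const_mul (r₁ ^ 2))).ofReal_comp
  have k23 := (dd.const_mul r₁).ofReal_comp
  have k30 := (((dβ.const_mul r₁).fun_add (dbt.const_mul r₂)).ofReal_comp).const_mul (-Complex.I)
  have k31 := ((((((dct.fun_pow 2).const_mul r₂).fun_sub ((dd.const_mul r₁).fun_mul ddt)).sub_const
    (2 * (σ₂ * s))).ofReal_comp).sub_const ((r₂ : ℂ) * z)).const_mul Complex.I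
  have k32 := (ddt.const_mul r₂).fun_neg.ofReal_comp
  have k33 := ((dct.const_mul r₂).fun_neg.fun_sub (dτ.const_mul (r₂ ^ 2))).ofReal_comp
  fin_cases i <;> fin_cases j
  · exact k00.congr_deriv (by simp)
  · exact k01.congr_deriv (by simp)
  · exact hasDerivAt_const _ _
  · exact hasDerivAt_const _ _
  · exact k10.congr_deriv (by simp)
  · exact k11.congr_deriv (by simp)
  · exact hasDerivAt_const _ _
  · exact hasDerivAt_const _ _
  · exact k20.congr_deriv (by simp; ring)
  · exact k21.congr_deriv (by simp)
  · exact k22.congr_deriv (by simp)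
  · exact k23.congr_deriv (by simp)
  · exact k30.congr_deriv (by simp)
  · exact k31.congr_deriv (by simp; ring)
  · exact k32.congr_deriv (by simp)
  · exact k33.congr_deriv (by simp)
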